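/- arXiv:math/0503377 — 3 statements merged into one kernel-verified Lean document; each statement's English description precedes it below -/
import Mathlib

section
/- The functions x \mapsto C(x)/S(x) and x \mapsto S(x)/S'(x) are strictly increasing on the interval (-\pi^2, \infty), and for every x > -\pi^2 one has x < C(x)/(2 S'(x)). -/
open Real

/-- `C x = ∑ xⁿ/(2n)!`, i.e. `cosh √x` for `x ≥ 0` and `cos √(-x)` for `x ≤ 0`. -/
noncomputable def C (x : ℝ) : ℝ := ∑' n : ℕ, x ^ n / (Nat.factorial (2 * n))

/-- `S x = ∑ xⁿ/(2n+1)!`, i.e. `sinh √x/√x` for `x > 0` and `sin √(-x)/√(-x)` for `x < 0`. -/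
noncomputable def S (x : ℝ) : ℝ := ∑' n : ℕ, x ^ n / (Nat.factorial (2 * n + 1))

theorem summable_C_term (x : ℝ) :
    Summable fun n : ℕ => x ^ n / (Nat.factorial (2 * n) : ℝ) := by
  refine Summable.of_norm_bounded (Real.summable_pow_div_factorial |x|) fun n => ?_
  rw [norm_div, norm_pow, Real.norm_eq_abs, Real.norm_natCast]
  gcongr
  omega

theorem summable_S_term (x : ℝ) :
    Summable fun n : ℕ => x ^ n / (Nat.factorial (2 * n + 1) : ℝ) := by
  refine Summable.of_norm_bounded (Real.summable_pow_div_factorial |x|) fun n => ?_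
  rw [norm_div, norm_pow, Real.norm_eq_abs, Real.norm_natCast]
  gcongr
  omega

theorem norm_deriv_S_term_le {x R : ℝ} (hR : 1 ≤ R) (hx : |x| ≤ R) (n : ℕ) :
    ‖(n : ℝ) * x ^ (n - 1) / (Nat.factorial (2 * n + 1) : ℝ)‖ ≤
      R ^ n / (Nat.factorial n : ℝ) := by
  rw [norm_div, norm_mul, norm_pow, Real.norm_eq_abs x, Real.norm_natCast, Real.norm_natCast]
  have hfac : (n + 1) * Nat.factorial n ≤ Nat.factorial (2 * n + 1) := by
    rw [← Nat.factorial_succ]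
    exact Nat.factorial_le (by omega)
  have hfac' : ((n : ℝ) + 1) * (Nat.factorial n : ℝ) ≤ (Nat.factorial (2 * n + 1) : ℝ) := by
    exact_mod_cast hfac
  have hpow : |x| ^ (n - 1) ≤ R ^ n :=
    (pow_le_pow_left₀ (abs_nonneg x) hx _).trans (pow_le_pow_right₀ hR (Nat.sub_le n 1))
  have hRn : 0 ≤ R ^ n := by positivity
  have hn : (0 : ℝ) < (Nat.factorial n : ℝ) := by positivity
  rw [div_le_div_iff₀ (by positivity) hn]
  calc (n : ℝ) * |x| ^ (n - 1) * (Nat.factorial n : ℝ)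
      ≤ ((n : ℝ) + 1) * R ^ n * (Nat.factorial n : ℝ) := by gcongr; linarith
    _ = R ^ n * (((n : ℝ) + 1) * (Nat.factorial n : ℝ)) := by ring
    _ ≤ R ^ n * (Nat.factorial (2 * n + 1) : ℝ) := by gcongr

theorem hasDerivAt_S (x : ℝ) :
    HasDerivAt S (∑' n : ℕ, (n : ℝ) * x ^ (n - 1) / (Nat.factorial (2 * n + 1) : ℝ)) x := by
  have hx : x ∈ Metric.ball (0 : ℝ) (|x| + 1) := by simp
  refine hasDerivAt_tsum_of_isPreconnected
    (g := fun (n : ℕ) (y : ℝ) => y ^ n / (Nat.factorial (2 * n + 1) : ℝ))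
    (g' := fun (n : ℕ) (y : ℝ) => (n : ℝ) * y ^ (n - 1) / (Nat.factorial (2 * n + 1) : ℝ))
    (Real.summable_pow_div_factorial (|x| + 1)) Metric.isOpen_ball
    (convex_ball (0 : ℝ) (|x| + 1)).isPreconnected
    (fun n y _ => (hasDerivAt_pow n y).div_const _) (fun n y hy => ?_) hx (summable_S_term x) hx
  refine norm_deriv_S_term_le (by linarith [abs_nonneg x]) ?_ n
  simpa using (mem_ball_zero_iff.mp hy).le

theorem C_zero : C 0 = 1 := by
  rw [C, tsum_eq_single 0 fun n hn => by simp [hn]]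
  simp

theorem S_zero : S 0 = 1 := by
  rw [S, tsum_eq_single 0 fun n hn => by simp [hn]]
  simp

theorem deriv_S_zero : deriv S 0 = 1 / 6 := by
  rw [(hasDerivAt_S 0).deriv, tsum_eq_single 1]
  · norm_num [Nat.factorial]
  · intro n hn
    rcases Nat.eq_zero_or_pos n with rfl | h
    · simp
    · rw [zero_pow (by omega)]
      simp

theorem two_mul_mul_deriv_S (x : ℝ) : 2 * x * deriv S x = C x - S x := by
  rw [(hasDerivAt_S x).deriv, C, S, ← (summable_C_term x).tsum_sub (summable_S_term x),
    ← tsum_mul_left]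
  refine tsum_congr fun n => ?_
  have hn : (Nat.factorial (2 * n) : ℝ) ≠ 0 := by positivity
  rw [Nat.factorial_succ]
  push_cast
  rcases n with _ | n
  · simp
  · rw [Nat.add_sub_cancel]
    push_cast
    field_simp
    ring

theorem ofReal_C_eq_cos {x : ℝ} {z : ℂ} (hz : z ^ 2 = -x) : (C x : ℂ) = Complex.cos z := by
  rw [C, Complex.ofReal_tsum, ← (Complex.hasSum_cos z).tsum_eq]
  refine tsum_congr fun n => ?_
  rw [pow_mul, hz, ← mul_pow]
  push_cast
  simp

theorem mul_ofReal_S_eq_sin {x : ℝ} {z : ℂ} (hz : z ^ 2 = -x) :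
    z * (S x : ℂ) = Complex.sin z := by
  rw [S, Complex.ofReal_tsum, ← (Complex.hasSum_sin z).tsum_eq, ← tsum_mul_left]
  refine tsum_congr fun n => ?_
  rw [pow_succ, pow_mul, hz, ← mul_assoc, ← mul_pow]
  push_cast
  simp
  ring

theorem S_pos {x : ℝ} (hx : -π ^ 2 < x) : 0 < S x := by
  rcases le_or_gt 0 x with h | h
  · refine (summable_S_term x).tsum_pos (fun n => by positivity) 0 (by simp)
  · have ht : 0 < √(-x) := Real.sqrt_pos.mpr (by linarith)
    have htπ : √(-x) < π := by
      rw [Real.sqrt_lt' pi_pos]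
      linarith
    have hz : ((√(-x) : ℝ) : ℂ) ^ 2 = -x := by
      rw [← Complex.ofReal_pow, Real.sq_sqrt (by linarith)]
      simp
    have hsin : √(-x) * S x = Real.sin √(-x) := by
      exact_mod_cast mul_ofReal_S_eq_sin hz
    have := Real.sin_pos_of_pos_of_lt_pi ht htπ
    rw [← hsin] at this
    exact pos_of_mul_pos_right this ht.le

theorem add_sq_pos {x : ℝ} (hx : -π ^ 2 < x) (n : ℕ) : 0 < x + ((n + 1) * π) ^ 2 := by
  have h : (1 : ℝ) ≤ ((n : ℝ) + 1) ^ 2 := one_le_pow₀ (by simp)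
  nlinarith [pow_pos pi_pos 2]

theorem summable_partialFraction {x : ℝ} (hx : -π ^ 2 < x) :
    Summable fun n : ℕ => 1 / (x + ((n + 1) * π) ^ 2) := by
  rw [← summable_nat_add_iff 1]
  have hsum : Summable fun n : ℕ => 1 / π ^ 2 * (1 / ((n + 1 : ℕ) : ℝ) ^ 2) :=
    ((summable_nat_add_iff 1).mpr (Real.summable_one_div_nat_pow.mpr one_lt_two)).mul_left _
  refine Summable.of_nonneg_of_le (fun n => (one_div_pos.mpr (add_sq_pos hx _)).le)
    (fun n => ?_) hsum
  have hπ := pow_pos pi_pos 2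
  rw [one_div_mul_one_div]
  apply one_div_le_one_div_of_le (by positivity)
  push_cast
  nlinarith [mul_nonneg (Nat.cast_nonneg (α := ℝ) n) hπ.le]

theorem C_div_S_eq {x : ℝ} (hx : -π ^ 2 < x) :
    C x / S x = 1 + ∑' n : ℕ, 2 * x * (1 / (x + ((n + 1) * π) ^ 2)) := by
  rcases eq_or_ne x 0 with rfl | hx0
  · simp [C_zero, S_zero]
  obtain ⟨z, hz⟩ := IsAlgClosed.exists_pow_nat_eq (-x : ℂ) two_pos
  have hz0 : z ≠ 0 := by
    rintro rfl
    simp [hx0] at hz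
  have hπ : (π : ℂ) ≠ 0 := by exact_mod_cast pi_ne_zero
  have hS : (S x : ℂ) ≠ 0 := by exact_mod_cast (S_pos hx).ne'
  have hsin : Complex.sin z ≠ 0 := by
    rw [← mul_ofReal_S_eq_sin hz]
    exact mul_ne_zero hz0 hS
  have hw : z / π ∈ Complex.integerComplement := by
    rintro ⟨k, hk⟩
    apply hsin
    rw [eq_div_iff hπ] at hk
    rw [← hk, Complex.sin_int_mul_pi]
  have key := cot_series_rep' hw
  rw [mul_div_cancel₀ _ hπ, Complex.cot] at key
  have hC : (C x : ℂ) / S x = 1 + z / π * (π * (Complex.cos z / Complex.sin z) - 1 / (z / π)) := by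
    rw [ofReal_C_eq_cos hz, ← mul_ofReal_S_eq_sin hz]
    field_simp
    ring
  rw [key, ← tsum_mul_left] at hC
  have hterm (n : ℕ) : z / π * (1 / (z / π - (n + 1)) + 1 / (z / π + (n + 1))) =
      ((2 * x * (1 / (x + ((n + 1) * π) ^ 2)) : ℝ) : ℂ) := by
    have h1 : z / π - (n + 1) ≠ 0 := by
      simpa [sub_eq_add_neg] using
        Complex.integerComplement_add_ne_zero hw (-((n : ℤ) + 1))
    have h2 : z / π + (n + 1) ≠ 0 := by
      simpa using Complex.integerComplement_add_ne_zero hw ((n : ℤ) + 1)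
    have h3 : (x : ℂ) + ((n + 1) * π) ^ 2 ≠ 0 := by exact_mod_cast (add_sq_pos hx n).ne'
    have hx' : (x : ℂ) = -z ^ 2 := by rw [hz]; ring
    push_cast
    rw [div_add_div _ _ h1 h2, mul_one_div, mul_div_assoc', div_eq_div_iff (mul_ne_zero h1 h2) h3,
      hx']
    field_simp
    ring
  simp_rw [hterm] at hC
  rw [← Complex.ofReal_tsum] at hC
  exact_mod_cast hC

theorem deriv_S_div_S_eq {x : ℝ} (hx : -π ^ 2 < x) :
    deriv S x / S x = ∑' n : ℕ, 1 / (x + ((n + 1) * π) ^ 2) := by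
  rcases eq_or_ne x 0 with rfl | hx0
  · have h := ((hasSum_nat_add_iff' 1).mpr hasSum_zeta_two).mul_left (1 / π ^ 2)
    rw [deriv_S_zero, S_zero]
    have hval : 1 / π ^ 2 * (π ^ 2 / 6 - ∑ i ∈ Finset.range 1, 1 / (i : ℝ) ^ 2) = 1 / 6 / 1 := by
      simp
      field_simp
    rw [← hval, ← h.tsum_eq]
    refine tsum_congr fun n => ?_
    push_cast
    rw [one_div_mul_one_div]
    ring_nf
  · have hS := (S_pos hx).ne'
    have h := C_div_S_eq hx
    rw [tsum_mul_left] at h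
    have h2 := two_mul_mul_deriv_S x
    apply mul_left_cancel₀ (mul_ne_zero two_ne_zero hx0)
    rw [eq_sub_of_add_eq' h.symm, mul_div_assoc', h2]
    field_simp

theorem deriv_S_pos {x : ℝ} (hx : -π ^ 2 < x) : 0 < deriv S x := by
  have h : 0 < deriv S x / S x := by
    rw [deriv_S_div_S_eq hx]
    exact (summable_partialFraction hx).tsum_pos
      (fun n => (one_div_pos.mpr (add_sq_pos hx n)).le) 0 (one_div_pos.mpr (add_sq_pos hx 0))
  exact (div_pos_iff_of_pos_right (S_pos hx)).mp h

theorem strictMonoOn_C_div_S : StrictMonoOn (fun x => C x / S x) (Set.Ioi (-π ^ 2)) := by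
  intro x hx y hy hxy
  rw [Set.mem_Ioi] at hx hy
  have hlt (n : ℕ) : 2 * x * (1 / (x + ((n + 1) * π) ^ 2)) <
      2 * y * (1 / (y + ((n + 1) * π) ^ 2)) := by
    have ha : 0 < (((n : ℝ) + 1) * π) ^ 2 := by positivity
    rw [mul_one_div, mul_one_div, div_lt_div_iff₀ (add_sq_pos hx n) (add_sq_pos hy n)]
    nlinarith
  simp only [C_div_S_eq hx, C_div_S_eq hy]
  gcongr ?_ + ?_
  exact Summable.tsum_lt_tsum (fun n => (hlt n).le) (hlt 0)
    ((summable_partialFraction hx).mul_left _) ((summable_partialFraction hy).mul_left _)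

theorem strictMonoOn_S_div_deriv_S :
    StrictMonoOn (fun x => S x / deriv S x) (Set.Ioi (-π ^ 2)) := by
  intro x hx y hy hxy
  rw [Set.mem_Ioi] at hx hy
  have hlt (n : ℕ) : 1 / (y + ((n + 1) * π) ^ 2) < 1 / (x + ((n + 1) * π) ^ 2) :=
    one_div_lt_one_div_of_lt (add_sq_pos hx n) (by linarith)
  have h : deriv S y / S y < deriv S x / S x := by
    rw [deriv_S_div_S_eq hx, deriv_S_div_S_eq hy]
    exact Summable.tsum_lt_tsum (fun n => (hlt n).le) (hlt 0)
      (summable_partialFraction hy) (summable_partialFraction hx)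
  have h' := one_div_lt_one_div_of_lt (div_pos (deriv_S_pos hy) (S_pos hy)) h
  simpa only [one_div_div] using h'

/-- The quotients `C/S` and `S/S'` are strictly increasing on `(-π², ∞)`, and
`x < C(x)/(2S'(x))` there. -/
theorem stmt2 :
    StrictMonoOn (fun x => C x / S x) (Set.Ioi (-π ^ 2)) ∧
    StrictMonoOn (fun x => S x / deriv S x) (Set.Ioi (-π ^ 2)) ∧
    ∀ x : ℝ, x > -π ^ 2 → x < C x / (2 * deriv S x) := by
  refine ⟨strictMonoOn_C_div_S, strictMonoOn_S_div_deriv_S, fun x hx => ?_⟩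
  rw [lt_div_iff₀ (mul_pos two_pos (deriv_S_pos hx))]
  linarith [two_mul_mul_deriv_S x, S_pos hx]
end

section
/- The set \{ A(\Pi_1(g)) : g \in SL_2(\mathbb{C}) \} = \{ T\,\sigma(g)^{-1} g\,T^{-1} : g \in SL_2(\mathbb{C}) \} equals the set \mathcal{Q} of all matrices of the form [[s, b],[-\overline{b}, t]] with s, t \in \mathbb{R}, b \in \mathbb{C} and s t + |b|^2 = 1. -/
/-- The entrywise complex conjugation `σ` of `SL₂(ℂ)` (fixing `SL₂(ℝ)`), at the matrix level. -/
def sigmaConj (g : Matrix (Fin 2) (Fin 2) ℂ) : Matrix (Fin 2) (Fin 2) ℂ :=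
  g.map (starRingEnd ℂ)

/-- The matrix `T = (1/√2)·[[1, i],[i, 1]]` conjugating `SL₂(ℝ)` onto `SU(1,1)`. -/
noncomputable def T : Matrix (Fin 2) (Fin 2) ℂ :=
  ((Real.sqrt 2 : ℂ))⁻¹ • !![1, Complex.I; Complex.I, 1]

open Complex ComplexConjugate

theorem inv_sqrt_two_mul_self :
    (Real.sqrt 2 : ℂ)⁻¹ * (Real.sqrt 2 : ℂ)⁻¹ = ((1 / 2 : ℝ) : ℂ) := by
  rw [← mul_inv, ← ofReal_mul, Real.mul_self_sqrt zero_le_two]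
  norm_num

theorem T_inv : T⁻¹ = ((Real.sqrt 2 : ℂ))⁻¹ • !![1, -I; -I, 1] := by
  apply Matrix.inv_eq_right_inv
  rw [T, Matrix.smul_mul, Matrix.mul_smul, smul_smul, inv_sqrt_two_mul_self]
  ext i j
  fin_cases i <;> fin_cases j <;> norm_num [Matrix.mul_apply, Fin.sum_univ_two]

/-- Conjugation by `T` in the coordinates `x + i y, u, v` on the image of `Π₁`. -/
theorem T_mul_mul_T_inv (x y u v : ℝ) :
    T * !![(⟨x, y⟩ : ℂ), ⟨0, u⟩; ⟨0, v⟩, ⟨x, -y⟩] * T⁻¹ =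
      !![((x + (u - v) / 2 : ℝ) : ℂ), ⟨y, (u + v) / 2⟩;
        -(conj (⟨y, (u + v) / 2⟩ : ℂ)), ((x - (u - v) / 2 : ℝ) : ℂ)] := by
  rw [T_inv, T, Matrix.smul_mul, Matrix.smul_mul, Matrix.mul_smul, smul_smul, inv_sqrt_two_mul_self]
  ext i j
  fin_cases i <;> fin_cases j <;> apply Complex.ext <;>
    simp [-ofReal_div, -ofReal_inv, -ofReal_ofNat,
      -ofReal_add, -ofReal_sub] <;> ring

theorem det_sigmaConj (g : Matrix (Fin 2) (Fin 2) ℂ) : (sigmaConj g).det = conj g.det :=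
  ((starRingEnd ℂ).map_det g).symm

theorem sigmaConj_inv_mul_eq {g m : Matrix (Fin 2) (Fin 2) ℂ} (hg : g.det = 1)
    (h : sigmaConj g * m = g) : (sigmaConj g)⁻¹ * g = m := by
  have hu : IsUnit (sigmaConj g).det := by simp [det_sigmaConj, hg]
  nth_rewrite 2 [← h]
  rw [Matrix.nonsing_inv_mul_cancel_left _ _ hu]

/-- The image of `Π₁` consists of the matrices `[[z, i u], [i v, conj z]]` of determinant one. -/
theorem exists_sigmaConj_inv_mul_iff (m : Matrix (Fin 2) (Fin 2) ℂ) :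
    (∃ g : Matrix (Fin 2) (Fin 2) ℂ, g.det = 1 ∧ m = (sigmaConj g)⁻¹ * g) ↔
      ∃ x y u v : ℝ, x * x + y * y + u * v = 1 ∧
        m = !![(⟨x, y⟩ : ℂ), ⟨0, u⟩; ⟨0, v⟩, ⟨x, -y⟩] := by
  constructor
  · rintro ⟨g, hg, rfl⟩
    have hs : (sigmaConj g)⁻¹ = !![conj (g 1 1), -conj (g 0 1); -conj (g 1 0), conj (g 0 0)] := by
      rw [Matrix.inv_def, det_sigmaConj, hg, Matrix.adjugate_fin_two]
      simp [sigmaConj]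
    have hdet : ((sigmaConj g)⁻¹ * g).det = 1 := by
      simp [Matrix.det_nonsing_inv, det_sigmaConj, hg]
    have hm : (sigmaConj g)⁻¹ * g =
        !![(⟨(conj (g 1 1) * g 0 0 - conj (g 0 1) * g 1 0).re,
            (conj (g 1 1) * g 0 0 - conj (g 0 1) * g 1 0).im⟩ : ℂ),
          ⟨0, (conj (g 1 1) * g 0 1 - conj (g 0 1) * g 1 1).im⟩;
          ⟨0, (conj (g 0 0) * g 1 0 - conj (g 1 0) * g 0 0).im⟩,
          ⟨(conj (g 1 1) * g 0 0 - conj (g 0 1) * g 1 0).re,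
            -(conj (g 1 1) * g 0 0 - conj (g 0 1) * g 1 0).im⟩] := by
      rw [hs]
      ext i j
      fin_cases i <;> fin_cases j <;> apply Complex.ext <;>
        simp [Matrix.mul_apply, Fin.sum_univ_two] <;> ring
    refine ⟨_, _, _, _, ?_, hm⟩
    rw [hm, Matrix.det_fin_two_of] at hdet
    have := congrArg Complex.re hdet
    simp only [sub_re, mul_re, one_re] at this ⊢
    linarith
  · rintro ⟨x, y, u, v, h, rfl⟩
    rcases lt_or_ge (-1) x with hx | hx
    · have hr : 0 < 2 + 2 * x := by linarith
      obtain ⟨r, hr'⟩ : ∃ r : ℝ, r * r * (2 + 2 * x) = 1 :=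
        ⟨(√(2 + 2 * x))⁻¹, by
          rw [← mul_inv, Real.mul_self_sqrt hr.le, inv_mul_cancel₀ hr.ne']⟩
      have hg : (!![(⟨r * (1 + x), r * y⟩ : ℂ), ⟨0, r * u⟩;
          ⟨0, r * v⟩, ⟨r * (1 + x), -(r * y)⟩]).det = 1 := by
        rw [Matrix.det_fin_two_of]
        apply Complex.ext <;> simp
        · linear_combination hr' + r * r * h
        · ring
      refine ⟨_, hg, (sigmaConj_inv_mul_eq hg ?_).symm⟩
      ext i j
      fin_cases i <;> fin_cases j <;> apply Complex.ext <;>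
        simp [sigmaConj, Matrix.mul_apply, Fin.sum_univ_two] <;>
        first | ring1 | linear_combination r * h
    · have hr : 0 < 2 - 2 * x := by linarith
      obtain ⟨r, hr'⟩ : ∃ r : ℝ, r * r * (2 - 2 * x) = 1 :=
        ⟨(√(2 - 2 * x))⁻¹, by
          rw [← mul_inv, Real.mul_self_sqrt hr.le, inv_mul_cancel₀ hr.ne']⟩
      have hg : (!![(⟨r * y, r * (1 - x)⟩ : ℂ), ⟨r * u, 0⟩;
          ⟨-(r * v), 0⟩, ⟨r * y, -(r * (1 - x))⟩]).det = 1 := by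
        rw [Matrix.det_fin_two_of]
        apply Complex.ext <;> simp
        · linear_combination hr' + r * r * h
        · ring
      refine ⟨_, hg, (sigmaConj_inv_mul_eq hg ?_).symm⟩
      ext i j
      fin_cases i <;> fin_cases j <;> apply Complex.ext <;>
        simp [sigmaConj, Matrix.mul_apply, Fin.sum_univ_two] <;>
        first | ring1 | linear_combination r * h | linear_combination -r * h

/-- The set `{ A(Π₁(g)) : g ∈ SL₂(ℂ) } = { T σ(g)⁻¹ g T⁻¹ }` coincides with the set `𝒬` of
matrices `[[s, b],[-conj b, t]]` with `s, t ∈ ℝ`, `b ∈ ℂ` and `st + |b|² = 1`. -/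
theorem stmt8 :
    {h : Matrix (Fin 2) (Fin 2) ℂ |
        ∃ g : Matrix (Fin 2) (Fin 2) ℂ, g.det = 1 ∧ h = T * ((sigmaConj g)⁻¹ * g) * T⁻¹} =
      {q : Matrix (Fin 2) (Fin 2) ℂ |
        ∃ (s t : ℝ) (b : ℂ), s * t + Complex.normSq b = 1 ∧
          q = !![(s : ℂ), b; -(starRingEnd ℂ b), (t : ℂ)]} := by
  ext q
  constructor
  · rintro ⟨g, hg, rfl⟩
    obtain ⟨x, y, u, v, h, hm⟩ := (exists_sigmaConj_inv_mul_iff _).1 ⟨g, hg, rfl⟩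
    refine ⟨_, _, _, ?_, hm ▸ T_mul_mul_T_inv x y u v⟩
    rw [normSq_mk]
    linear_combination h
  · rintro ⟨s, t, b, h, rfl⟩
    rw [normSq_apply] at h
    obtain ⟨g, hg, hm⟩ := (exists_sigmaConj_inv_mul_iff _).2
      ⟨(s + t) / 2, b.re, b.im + (s - t) / 2, b.im - (s - t) / 2,
        by linear_combination h, rfl⟩
    refine ⟨g, hg, ?_⟩
    rw [← hm, T_mul_mul_T_inv]
    ring_nf
end

section
/- Let m > -1 with m \neq 0, and let u \neq 0 be real. Then (m/(1+m))\cdot C(4u^2(1+m)^2)/S(4u^2(1+m)^2) < C(4u^2m^2)/S(4u^2m^2). -/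
open Real

theorem C_sq (x : ℝ) : C (x ^ 2) = cosh x := by
  rw [C, cosh_eq_tsum]
  simp only [pow_mul]

theorem mul_S_sq (x : ℝ) : x * S (x ^ 2) = sinh x := by
  rw [S, sinh_eq_tsum, ← tsum_mul_left]
  refine tsum_congr fun n => ?_
  ring

theorem S_sq_pos {x : ℝ} (hx : x ≠ 0) : 0 < S (x ^ 2) := by
  have h := mul_S_sq x
  rcases hx.lt_or_gt with hx | hx
  · have := sinh_neg_iff.2 hx
    exact pos_of_mul_neg_right (h ▸ this) hx.le
  · have := sinh_pos_iff.2 hx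
    exact pos_of_mul_pos_right (h ▸ this) hx.le

/-- The subtraction formula for `sinh (2u(1+m) - 2um)`, divided by `2u`. -/
theorem S_mul_C_sub_C_mul_S (m : ℝ) {u : ℝ} (hu : u ≠ 0) :
    (1 + m) * S ((2 * u * (1 + m)) ^ 2) * C ((2 * u * m) ^ 2) -
      m * C ((2 * u * (1 + m)) ^ 2) * S ((2 * u * m) ^ 2) = S ((2 * u) ^ 2) := by
  have h := sinh_sub (2 * u * (1 + m)) (2 * u * m)
  rw [show 2 * u * (1 + m) - 2 * u * m = 2 * u by ring] at h
  simp only [← mul_S_sq, ← C_sq] at h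
  apply mul_left_cancel₀ (mul_ne_zero two_ne_zero hu)
  linear_combination -h

/-- For `m > -1`, `m ≠ 0` and `u ≠ 0` one has
`(m/(1+m))·C(4u²(1+m)²)/S(4u²(1+m)²) < C(4u²m²)/S(4u²m²)`. -/
theorem stmt15 (m u : ℝ) (hm : -1 < m) (hm0 : m ≠ 0) (hu : u ≠ 0) :
    m / (1 + m) * (C (4 * u ^ 2 * (1 + m) ^ 2) / S (4 * u ^ 2 * (1 + m) ^ 2)) <
      C (4 * u ^ 2 * m ^ 2) / S (4 * u ^ 2 * m ^ 2) := by
  have hm1 : 0 < 1 + m := by linarith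
  have h2u : 2 * u ≠ 0 := mul_ne_zero two_ne_zero hu
  rw [show 4 * u ^ 2 * (1 + m) ^ 2 = (2 * u * (1 + m)) ^ 2 by ring,
    show 4 * u ^ 2 * m ^ 2 = (2 * u * m) ^ 2 by ring, div_mul_div_comm,
    div_lt_div_iff₀ (mul_pos hm1 (S_sq_pos (mul_ne_zero h2u hm1.ne')))
      (S_sq_pos (mul_ne_zero h2u hm0))]
  linarith [S_mul_C_sub_C_mul_S m hu, S_sq_pos h2u]
end
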